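/- arXiv:1101.3689 — 2 statements merged into one kernel-verified Lean document; each statement's English description precedes it below -/
import Mathlib

section
/- Every homogeneous polynomial p of degree d in n real variables admits a harmonic decomposition: there exist polynomials h_0, h_1, …, h_{⌊d/2⌋} in n variables such that for each j, h_j is homogeneous of degree d − 2j and Δh_j = 0, and p = Σ_{j=0}^{⌊d/2⌋} q^j · h_j, where q = Σ_{i=1}^{n} x_i². -/
open MvPolynomial Finset

/-- The polynomial Laplacian `Δp = ∑ i, ∂²p/∂xᵢ²`. -/
noncomputable def polyLaplacian {n : ℕ} (p : MvPolynomial (Fin n) ℝ) :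
    MvPolynomial (Fin n) ℝ :=
  ∑ i : Fin n, pderiv i (pderiv i p)

lemma polyLaplacian_sub {n : ℕ} (f g : MvPolynomial (Fin n) ℝ) :
    polyLaplacian (f - g) = polyLaplacian f - polyLaplacian g := by
  simp [polyLaplacian, Finset.sum_sub_distrib]

lemma polyLaplacian_C_mul {n : ℕ} (c : ℝ) (f : MvPolynomial (Fin n) ℝ) :
    polyLaplacian (C c * f) = C c * polyLaplacian f := by
  simp only [polyLaplacian, pderiv_C_mul, Finset.mul_sum]

lemma polyLaplacian_sum {n : ℕ} {ι : Type*} (s : Finset ι) (f : ι → MvPolynomial (Fin n) ℝ) :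
    polyLaplacian (∑ k ∈ s, f k) = ∑ k ∈ s, polyLaplacian (f k) := by
  simp only [polyLaplacian, map_sum]
  exact Finset.sum_comm

lemma polyLaplacian_isHomogeneous {n m : ℕ} {f : MvPolynomial (Fin n) ℝ}
    (hf : f.IsHomogeneous m) : (polyLaplacian f).IsHomogeneous (m - 2) :=
  IsHomogeneous.sum _ _ _ fun _ _ => hf.pderiv.pderiv

lemma polyLaplacian_eq_zero_of_lt_two {n m : ℕ} {f : MvPolynomial (Fin n) ℝ}
    (hf : f.IsHomogeneous m) (hm : m < 2) : polyLaplacian f = 0 := by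
  refine Finset.sum_eq_zero fun i _ => ?_
  have h : (pderiv i f).IsHomogeneous 0 := by
    simpa [show m - 1 = 0 by lia] using hf.pderiv (i := i)
  rw [totalDegree_eq_zero_iff_eq_C.mp (Nat.le_zero.mp h.totalDegree_le), pderiv_C]

lemma isHomogeneous_sum_X_sq (n : ℕ) :
    (∑ i : Fin n, X i ^ 2 : MvPolynomial (Fin n) ℝ).IsHomogeneous 2 :=
  IsHomogeneous.sum _ _ _ fun i _ => isHomogeneous_X_pow i 2

lemma pderiv_sum_X_sq {n : ℕ} (i : Fin n) :
    pderiv i (∑ k : Fin n, X k ^ 2 : MvPolynomial (Fin n) ℝ) = 2 * X i := by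
  simp [pderiv_X, Pi.single_apply]

/-- `Δ(q f) = (2n + 4m) f + q Δf` for `f` homogeneous of degree `m`. -/
lemma polyLaplacian_sum_X_sq_mul {n m : ℕ} {f : MvPolynomial (Fin n) ℝ}
    (hf : f.IsHomogeneous m) :
    polyLaplacian ((∑ i : Fin n, X i ^ 2) * f) =
      (2 * n + 4 * m : MvPolynomial (Fin n) ℝ) * f + (∑ i : Fin n, X i ^ 2) * polyLaplacian f := by
  have euler : ∑ i, X i * pderiv i f = (m : MvPolynomial (Fin n) ℝ) * f := by
    rw [hf.sum_X_mul_pderiv, nsmul_eq_mul]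
  set q : MvPolynomial (Fin n) ℝ := ∑ i : Fin n, X i ^ 2 with hq
  have key (i : Fin n) : pderiv i (pderiv i (q * f)) =
      2 * f + 4 * (X i * pderiv i f) + q * pderiv i (pderiv i f) := by
    have h2 : pderiv i (2 : MvPolynomial (Fin n) ℝ) = 0 := pderiv_C (a := (2 : ℝ))
    simp only [pderiv_mul, map_add, hq, pderiv_sum_X_sq, pderiv_X_self, h2]
    ring
  simp only [polyLaplacian, key, Finset.sum_add_distrib, ← Finset.mul_sum, euler]
  simp
  ring

/-- `Δ(q^(j+1) h) = 2(j+1)(n + 2m + 2j) q^j h` for `h` harmonic and homogeneous of degree `m`. -/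
lemma polyLaplacian_sum_X_sq_pow_succ_mul {n m : ℕ} {h : MvPolynomial (Fin n) ℝ}
    (hh : h.IsHomogeneous m) (h0 : polyLaplacian h = 0) (j : ℕ) :
    polyLaplacian ((∑ i : Fin n, X i ^ 2) ^ (j + 1) * h) =
      C (2 * (j + 1) * (n + 2 * m + 2 * j) : ℝ) * ((∑ i : Fin n, X i ^ 2) ^ j * h) := by
  have hC2 : (C 2 : MvPolynomial (Fin n) ℝ) = 2 := map_ofNat C 2
  have hom (k : ℕ) := ((isHomogeneous_sum_X_sq n).pow k).mul hh
  induction j with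
  | zero =>
    rw [zero_add, pow_one, polyLaplacian_sum_X_sq_mul hh, h0]
    simp only [map_mul, map_add, map_natCast, map_one, hC2]
    push_cast
    ring
  | succ j ih =>
    rw [pow_succ' _ (j + 1), mul_assoc, polyLaplacian_sum_X_sq_mul (hom (j + 1)), ih]
    simp only [map_mul, map_add, map_natCast, map_one, hC2]
    push_cast
    ring

/-- Every homogeneous polynomial of degree `d` in `n` real variables admits a harmonic
decomposition `p = ∑_{j=0}^{⌊d/2⌋} qʲ · hⱼ` with each `hⱼ` harmonic and homogeneous of
degree `d - 2j`, where `q = ∑ xᵢ²`. -/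
theorem harmonic_decomposition_exists (n d : ℕ) (hn : 1 ≤ n)
    (p : MvPolynomial (Fin n) ℝ) (hp : p.IsHomogeneous d) :
    ∃ h : ℕ → MvPolynomial (Fin n) ℝ,
      (∀ j ≤ d / 2, (h j).IsHomogeneous (d - 2 * j)) ∧
      (∀ j ≤ d / 2, polyLaplacian (h j) = 0) ∧
      p = ∑ j ∈ Finset.range (d / 2 + 1), (∑ i : Fin n, X i ^ 2) ^ j * h j := by
  induction d using Nat.strong_induction_on generalizing p with
  | _ d ih =>
  rcases lt_or_ge d 2 with hd | hd
  · have hd2 : d / 2 = 0 := by lia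
    refine ⟨fun _ => p, fun j hj => ?_, fun _ _ => polyLaplacian_eq_zero_of_lt_two hp hd, ?_⟩
    · simpa [show j = 0 by lia] using hp
    · simp [hd2]
  obtain ⟨g, hg, hg0, hsum⟩ := ih (d - 2) (by lia) _ (polyLaplacian_isHomogeneous hp)
  have hd2 : d / 2 = (d - 2) / 2 + 1 := by lia
  set q : MvPolynomial (Fin n) ℝ := ∑ i : Fin n, X i ^ 2
  let c (j : ℕ) : ℝ := 2 * (j + 1) * (n + 2 * (d - 2 - 2 * j : ℕ) + 2 * j)
  have hc (j : ℕ) : c j ≠ 0 := by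
    have : (0 : ℝ) < n := by exact_mod_cast hn
    positivity
  let u (j : ℕ) : MvPolynomial (Fin n) ℝ := C (c j)⁻¹ * g j
  have hu (j : ℕ) (hj : j ≤ (d - 2) / 2) : (u j).IsHomogeneous (d - 2 * (j + 1)) := by
    simpa [show d - 2 * (j + 1) = d - 2 - 2 * j by lia] using (hg j hj).C_mul (c j)⁻¹
  have hu0 (j : ℕ) (hj : j ≤ (d - 2) / 2) : polyLaplacian (u j) = 0 := by
    rw [polyLaplacian_C_mul, hg0 j hj, mul_zero]
  let r : MvPolynomial (Fin n) ℝ := ∑ j ∈ Finset.range ((d - 2) / 2 + 1), q ^ (j + 1) * u j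
  have hr : r.IsHomogeneous d := by
    refine IsHomogeneous.sum _ _ _ fun j hj => ?_
    have hj' : j ≤ (d - 2) / 2 := by simpa [Nat.lt_succ_iff] using hj
    have := ((isHomogeneous_sum_X_sq n).pow (j + 1)).mul (hu j hj')
    rwa [show 2 * (j + 1) + (d - 2 * (j + 1)) = d by lia] at this
  have hrΔ : polyLaplacian r = polyLaplacian p := by
    rw [hsum, polyLaplacian_sum]
    refine Finset.sum_congr rfl fun j hj => ?_
    have hj' : j ≤ (d - 2) / 2 := by simpa [Nat.lt_succ_iff] using hj
    rw [show q ^ (j + 1) * u j = C (c j)⁻¹ * (q ^ (j + 1) * g j) by ring,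
      polyLaplacian_C_mul, polyLaplacian_sum_X_sq_pow_succ_mul (hg j hj') (hg0 j hj'),
      ← mul_assoc, ← C_mul, inv_mul_cancel₀ (hc j), C_1, one_mul]
  refine ⟨fun j => Nat.casesOn j (p - r) u, ?_, ?_, ?_⟩
  · rintro (_ | j) hj
    · exact hp.sub hr
    · exact hu j (by lia)
  · rintro (_ | j) hj
    · simp [polyLaplacian_sub, hrΔ]
    · exact hu0 j (by lia)
  · rw [hd2, Finset.sum_range_succ']
    simp [r]
end

section
/- A harmonic homogeneous polynomial of positive degree has zero mean over the unit sphere: if h is a polynomial in n real variables (n ≥ 2) that is homogeneous of degree m ≥ 1 and satisfies Δh = 0, then the integral of the evaluation function x ↦ h(x) over the unit sphere {x ∈ ℝⁿ : |x| = 1} with respect to the (n−1)-dimensional Hausdorff measure is zero. -/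
open MvPolynomial Finset MeasureTheory

open scoped Topology

/-- The infinitesimal rotation `xᵢ ∂/∂xⱼ - xⱼ ∂/∂xᵢ`, acting on polynomials. -/
noncomputable def angularDerivation {n : ℕ} (i j : Fin n) :
    Derivation ℝ (MvPolynomial (Fin n) ℝ) (MvPolynomial (Fin n) ℝ) :=
  (X i : MvPolynomial (Fin n) ℝ) • pderiv j - (X j : MvPolynomial (Fin n) ℝ) • pderiv i

lemma angularDerivation_apply {n : ℕ} (i j : Fin n) (p : MvPolynomial (Fin n) ℝ) :
    angularDerivation i j p = X i * pderiv j p - X j * pderiv i p := by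
  simp [angularDerivation]

lemma angularDerivation_self {n : ℕ} (i : Fin n) (p : MvPolynomial (Fin n) ℝ) :
    angularDerivation i i p = 0 := by
  simp [angularDerivation_apply]

lemma angularDerivation_angularDerivation {n : ℕ} (i j : Fin n) (p : MvPolynomial (Fin n) ℝ) :
    angularDerivation i j (angularDerivation i j p) =
      (if i = j then X i * pderiv j p + X j * pderiv i p else 0)
        + X i ^ 2 * pderiv j (pderiv j p) + X j ^ 2 * pderiv i (pderiv i p)
        - X i * (X j * pderiv j (pderiv i p)) - X j * (X i * pderiv i (pderiv j p))
        - X i * pderiv i p - X j * pderiv j p := by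
  simp only [angularDerivation_apply, map_sub, pderiv_mul]
  rcases eq_or_ne i j with rfl | hij
  · simp only [pderiv_X_self, if_true]
    ring
  · rw [pderiv_X_self, pderiv_X_self, pderiv_X_of_ne hij, pderiv_X_of_ne hij.symm, if_neg hij]
    ring

/-- The Casimir identity for the rotation group on homogeneous polynomials. -/
lemma MvPolynomial.IsHomogeneous.sum_angularDerivation_sq {n m : ℕ} (hm : 1 ≤ m)
    {p : MvPolynomial (Fin n) ℝ} (hp : p.IsHomogeneous m) :
    ∑ i, ∑ j, angularDerivation i j (angularDerivation i j p) =
      C 2 * (∑ i, X i ^ 2) * polyLaplacian p - C (2 * (m * (m + n - 2) : ℝ)) * p := by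
  have euler : ∑ i, X i * pderiv i p = C (m : ℝ) * p := by
    rw [hp.sum_X_mul_pderiv, nsmul_eq_mul]
    simp
  have euler' (i : Fin n) :
      ∑ j, X j * pderiv j (pderiv i p) = C ((m : ℝ) - 1) * pderiv i p := by
    rw [(hp.pderiv (i := i)).sum_X_mul_pderiv, nsmul_eq_mul, Nat.cast_sub hm]
    simp
  have second : ∑ i, ∑ j, X i * (X j * pderiv j (pderiv i p)) =
      C ((m : ℝ) - 1) * (C (m : ℝ) * p) := by
    simp_rw [← mul_sum, euler', ← euler, mul_sum]
    exact sum_congr rfl fun i _ => by ring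
  have second' : ∑ i, ∑ j, X j * (X i * pderiv i (pderiv j p)) =
      C ((m : ℝ) - 1) * (C (m : ℝ) * p) := by
    rw [sum_comm, second]
  simp_rw [angularDerivation_angularDerivation, sum_sub_distrib, sum_add_distrib, second, second',
    sum_ite_eq, if_pos (mem_univ _), sum_add_distrib, ← mul_sum, sum_const, mul_smul_comm, ← smul_sum, euler,
    ← sum_mul, ← mul_sum, card_univ, Fintype.card_fin]
  rw [← polyLaplacian]
  simp only [nsmul_eq_mul, map_mul, map_sub, map_add, map_natCast, map_ofNat, map_one]
  ring

/-- The rotation by the angle `θ` in the plane spanned by the `i`-th and `j`-th axes. -/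
noncomputable def planeRotation {n : ℕ} (i j : Fin n) (hij : i ≠ j) (θ : ℝ) :
    EuclideanSpace ℝ (Fin n) ≃ₗᵢ[ℝ] EuclideanSpace ℝ (Fin n) :=
  LinearIsometry.toLinearIsometryEquiv
    { toFun := fun x => WithLp.toLp 2 fun k =>
        if k = i then Real.cos θ * x i - Real.sin θ * x j
        else if k = j then Real.sin θ * x i + Real.cos θ * x j else x k
      map_add' := fun x y => by
        ext k
        simp only [PiLp.add_apply]
        split_ifs <;> ring
      map_smul' := fun c x => by
        ext k
        simp only [PiLp.smul_apply, smul_eq_mul, RingHom.id_apply]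
        split_ifs <;> ring
      norm_map' := fun x => by
        rw [← sq_eq_sq₀ (norm_nonneg _) (norm_nonneg _), EuclideanSpace.real_norm_sq_eq,
          EuclideanSpace.real_norm_sq_eq]
        have hj : j ∈ univ.erase i := mem_erase.2 ⟨hij.symm, mem_univ _⟩
        rw [← add_sum_erase _ _ (mem_univ i), ← add_sum_erase _ _ hj,
          ← add_sum_erase univ (fun k => x k ^ 2) (mem_univ i),
          ← add_sum_erase _ (fun k => x k ^ 2) hj]
        have key : ∀ k ∈ (univ.erase i).erase j,
            (if k = i then Real.cos θ * x i - Real.sin θ * x j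
              else if k = j then Real.sin θ * x i + Real.cos θ * x j else x k) ^ 2 = x k ^ 2 := by
          intro k hk
          simp only [mem_erase] at hk
          rw [if_neg hk.2.1, if_neg hk.1]
        simp only [LinearMap.coe_mk, AddHom.coe_mk]
        rw [sum_congr rfl key, if_pos trivial, if_neg hij.symm, if_pos trivial]
        linear_combination (x i ^ 2 + x j ^ 2) * Real.sin_sq_add_cos_sq θ } rfl

lemma planeRotation_apply {n : ℕ} (i j : Fin n) (hij : i ≠ j) (θ : ℝ)
    (x : EuclideanSpace ℝ (Fin n)) (k : Fin n) :
    planeRotation i j hij θ x k = if k = i then Real.cos θ * x i - Real.sin θ * x j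
      else if k = j then Real.sin θ * x i + Real.cos θ * x j else x k := rfl

lemma planeRotation_zero {n : ℕ} (i j : Fin n) (hij : i ≠ j) (x : EuclideanSpace ℝ (Fin n)) :
    planeRotation i j hij 0 x = x := by
  ext k
  rw [planeRotation_apply]
  split_ifs <;> simp_all

lemma hasDerivAt_eval_planeRotation {n : ℕ} (i j : Fin n) (hij : i ≠ j)
    (x : EuclideanSpace ℝ (Fin n)) (p : MvPolynomial (Fin n) ℝ) (θ : ℝ) :
    HasDerivAt (fun t => eval (planeRotation i j hij t x : Fin n → ℝ) p)
      (eval (planeRotation i j hij θ x : Fin n → ℝ) (angularDerivation i j p)) θ := by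
  induction p using MvPolynomial.induction_on with
  | C a => simpa [derivation_C] using hasDerivAt_const θ a
  | add p q hp hq =>
    simp only [map_add]
    exact hp.add hq
  | mul_X p k hp =>
    have hk : HasDerivAt (fun t => planeRotation i j hij t x k)
        (eval (planeRotation i j hij θ x : Fin n → ℝ) (angularDerivation i j (X k))) θ := by
      have hc := Real.hasDerivAt_cos θ
      have hs := Real.hasDerivAt_sin θ
      simp only [angularDerivation_apply, map_sub, map_mul, eval_X, planeRotation_apply]
      rcases eq_or_ne k i with rfl | hki
      · simp only [if_true, if_neg hij.symm, pderiv_X_self, pderiv_X_of_ne hij, map_one, map_zero]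
        convert! (hc.mul_const (x k)).sub (hs.mul_const (x j)) using 1
        ring
      · rcases eq_or_ne k j with rfl | hkj
        · simp only [if_true, if_neg hki, pderiv_X_self, pderiv_X_of_ne hki, map_one, map_zero]
          convert! (hs.mul_const (x i)).add (hc.mul_const (x k)) using 1
          ring
        · simpa only [if_neg hki, if_neg hkj, pderiv_X_of_ne hki, pderiv_X_of_ne hkj, map_zero,
            mul_zero, sub_zero] using hasDerivAt_const θ (x k)
    have := hp.mul hk
    simp only [Derivation.leibniz, smul_eq_mul, map_add, map_mul, eval_X]
    convert! this using 1
    ring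

lemma continuous_eval_euclideanSpace {n : ℕ} (p : MvPolynomial (Fin n) ℝ) :
    Continuous fun x : EuclideanSpace ℝ (Fin n) => eval (x : Fin n → ℝ) p :=
  (MvPolynomial.continuous_eval p).comp (PiLp.continuous_ofLp 2 _)

lemma LinearIsometryEquiv.preimage_sphere_zero {E : Type*} [NormedAddCommGroup E]
    [NormedSpace ℝ E] (e : E ≃ₗᵢ[ℝ] E) (r : ℝ) :
    e ⁻¹' Metric.sphere 0 r = Metric.sphere 0 r := by
  ext x
  simp

lemma setIntegral_sphere_comp_linearIsometryEquiv {n : ℕ} (d : ℝ)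
    (e : EuclideanSpace ℝ (Fin n) ≃ₗᵢ[ℝ] EuclideanSpace ℝ (Fin n))
    (f : EuclideanSpace ℝ (Fin n) → ℝ) :
    ∫ x in Metric.sphere 0 1, f (e x) ∂μH[d] = ∫ x in Metric.sphere 0 1, f x ∂μH[d] := by
  have := (e.toIsometryEquiv.measurePreserving_hausdorffMeasure d).setIntegral_preimage_emb
    e.toHomeomorph.measurableEmbedding f (Metric.sphere 0 1)
  rwa [LinearIsometryEquiv.coe_toIsometryEquiv, e.preimage_sphere_zero] at this

/-- Rotation invariance makes infinitesimal rotations integrate to zero over the sphere. -/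
lemma setIntegral_sphere_angularDerivation {n : ℕ} (d : ℝ)
    (hfin : μH[d] (Metric.sphere (0 : EuclideanSpace ℝ (Fin n)) 1) < ⊤)
    (i j : Fin n) (p : MvPolynomial (Fin n) ℝ) :
    ∫ x in Metric.sphere (0 : EuclideanSpace ℝ (Fin n)) 1,
      eval (x : Fin n → ℝ) (angularDerivation i j p) ∂μH[d] = 0 := by
  rcases eq_or_ne i j with rfl | hij
  · simp [angularDerivation_self]
  have : IsFiniteMeasure ((μH[d] : Measure (EuclideanSpace ℝ (Fin n))).restrict
      (Metric.sphere 0 1)) := isFiniteMeasure_restrict.2 hfin.ne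
  obtain ⟨K, hK⟩ := (isCompact_sphere (0 : EuclideanSpace ℝ (Fin n)) 1).exists_bound_of_continuousOn
    (continuous_eval_euclideanSpace (angularDerivation i j p)).continuousOn
  have hcont (q : MvPolynomial (Fin n) ℝ) (θ : ℝ) :=
    (continuous_eval_euclideanSpace q).comp (planeRotation i j hij θ).continuous
  obtain ⟨K', hK'⟩ := (isCompact_sphere (0 : EuclideanSpace ℝ (Fin n)) 1).exists_bound_of_continuousOn
    (hcont p 0).continuousOn
  have hderiv := (hasDerivAt_integral_of_dominated_loc_of_deriv_le
    (μ := (μH[d] : Measure (EuclideanSpace ℝ (Fin n))).restrict (Metric.sphere 0 1))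
    (F := fun θ x => eval (planeRotation i j hij θ x : Fin n → ℝ) p)
    (F' := fun θ x => eval (planeRotation i j hij θ x : Fin n → ℝ) (angularDerivation i j p))
    (x₀ := (0 : ℝ)) (s := Set.univ) (bound := fun _ => K) Filter.univ_mem
    (.of_forall fun θ => (hcont p θ).aestronglyMeasurable)
    (.of_bound (hcont p 0).aestronglyMeasurable K'
      ((ae_restrict_iff' Metric.isClosed_sphere.measurableSet).2 (.of_forall hK')))
    (hcont _ 0).aestronglyMeasurable
    ((ae_restrict_iff' Metric.isClosed_sphere.measurableSet).2 (.of_forall fun x hx θ _ =>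
      hK _ (by simpa using hx)))
    (integrable_const K)
    (.of_forall fun x θ _ => hasDerivAt_eval_planeRotation i j hij x p θ)).2
  simp_rw [planeRotation_zero,
    setIntegral_sphere_comp_linearIsometryEquiv d (planeRotation i j hij _)
      (fun x => eval (x : Fin n → ℝ) p)] at hderiv
  exact hderiv.unique (hasDerivAt_const _ _)

/-- By homogeneity of the sphere, its Hausdorff measure is finite as soon as some continuous
function that is not identically zero on it is integrable. -/
lemma hausdorffMeasure_sphere_lt_top_of_integrableOn {n : ℕ} (d : ℝ)
    {f : EuclideanSpace ℝ (Fin n) → ℝ} (hf : Continuous f)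
    (hint : IntegrableOn f (Metric.sphere 0 1) μH[d])
    {y : EuclideanSpace ℝ (Fin n)} (hy : y ∈ Metric.sphere 0 1) (hfy : f y ≠ 0) :
    μH[d] (Metric.sphere (0 : EuclideanSpace ℝ (Fin n)) 1) < ⊤ := by
  refine (isCompact_sphere _ _).measure_lt_top_of_nhdsWithin fun x hx => ?_
  obtain ⟨e, he⟩ : ∃ e : EuclideanSpace ℝ (Fin n) ≃ₗᵢ[ℝ] EuclideanSpace ℝ (Fin n), e x = y :=
    ⟨_, Submodule.reflection_sub (by simp_all)⟩
  have hpos : 0 < ‖f y‖ / 2 := by positivity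
  have hlt := hint.measure_norm_ge_lt_top hpos
  rw [Measure.restrict_apply' Metric.isClosed_sphere.measurableSet,
    ← e.toIsometryEquiv.hausdorffMeasure_preimage, LinearIsometryEquiv.coe_toIsometryEquiv,
    Set.preimage_inter, e.preimage_sphere_zero] at hlt
  refine ⟨_, Filter.inter_mem (mem_nhdsWithin_of_mem_nhds ?_) self_mem_nhdsWithin, hlt⟩
  have hev : ∀ᶠ z in 𝓝 x, ‖f y‖ / 2 < ‖f (e z)‖ :=
    (hf.comp e.continuous).norm.continuousAt.eventually_const_lt (by simp [he]; positivity)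
  exact hev.mono fun z hz => hz.le

/-- A harmonic homogeneous polynomial of positive degree has zero mean over the unit
sphere of `ℝⁿ` (with respect to the `(n-1)`-dimensional Hausdorff measure). -/
theorem harmonic_homogeneous_integral_sphere_eq_zero (n m : ℕ) (hn : 2 ≤ n) (hm : 1 ≤ m)
    (h : MvPolynomial (Fin n) ℝ) (hhom : h.IsHomogeneous m)
    (hharm : polyLaplacian h = 0) :
    ∫ x in Metric.sphere (0 : EuclideanSpace ℝ (Fin n)) 1,
      MvPolynomial.eval (x : Fin n → ℝ) h ∂(μH[(n : ℝ) - 1]) = 0 := by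
  by_cases hint : IntegrableOn (fun x : EuclideanSpace ℝ (Fin n) => eval (x : Fin n → ℝ) h)
    (Metric.sphere 0 1) μH[(n : ℝ) - 1]
  swap
  · exact integral_undef hint
  by_cases hzero : ∀ x ∈ Metric.sphere (0 : EuclideanSpace ℝ (Fin n)) 1,
    eval (x : Fin n → ℝ) h = 0
  · exact setIntegral_eq_zero_of_forall_eq_zero hzero
  push Not at hzero
  obtain ⟨y, hy, hhy⟩ := hzero
  have hfin := hausdorffMeasure_sphere_lt_top_of_integrableOn _
    (continuous_eval_euclideanSpace h) hint hy hhy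
  have : IsFiniteMeasure ((μH[(n : ℝ) - 1] : Measure (EuclideanSpace ℝ (Fin n))).restrict
      (Metric.sphere 0 1)) := isFiniteMeasure_restrict.2 hfin.ne
  have hI (q : MvPolynomial (Fin n) ℝ) : Integrable
      (fun x : EuclideanSpace ℝ (Fin n) => eval (x : Fin n → ℝ) q)
      ((μH[(n : ℝ) - 1]).restrict (Metric.sphere 0 1)) := by
    obtain ⟨K, hK⟩ := (isCompact_sphere (0 : EuclideanSpace ℝ (Fin n)) 1).exists_bound_of_continuousOn
      (continuous_eval_euclideanSpace q).continuousOn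
    exact .of_bound (continuous_eval_euclideanSpace q).aestronglyMeasurable K
      ((ae_restrict_iff' Metric.isClosed_sphere.measurableSet).2 (.of_forall hK))
  have hsum : ∫ x in Metric.sphere (0 : EuclideanSpace ℝ (Fin n)) 1, eval (x : Fin n → ℝ)
      (∑ i, ∑ j, angularDerivation i j (angularDerivation i j h)) ∂μH[(n : ℝ) - 1] = 0 := by
    simp_rw [map_sum]
    rw [integral_finsetSum _ fun i _ => integrable_finsetSum _ fun j _ => hI _]
    refine sum_eq_zero fun i _ => ?_
    rw [integral_finsetSum _ fun j _ => hI _]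
    exact sum_eq_zero fun j _ => setIntegral_sphere_angularDerivation _ hfin i j _
  simp only [hhom.sum_angularDerivation_sq hm, hharm, mul_zero, zero_sub, map_neg, map_mul,
    eval_C, integral_neg, neg_eq_zero] at hsum
  rw [integral_const_mul] at hsum
  refine (mul_eq_zero.1 hsum).resolve_left ?_
  have hn' : (2 : ℝ) ≤ n := by exact_mod_cast hn
  have hm' : (1 : ℝ) ≤ m := by exact_mod_cast hm
  have : (0 : ℝ) < m + n - 2 := by linarith
  positivity
end
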